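/- arXiv:2402.03756 — 9 statements merged into one kernel-verified Lean document; each statement's English description precedes it below -/
import Mathlib

section
/- Let U and Y be real Hilbert spaces, H : U → Y a bounded linear operator, Ĉ : U → U a bounded self-adjoint positive semidefinite operator, and Γ : Y → Y a bounded self-adjoint operator that is positive definite in the sense that there exists c > 0 with ⟨y, Γy⟩ ≥ c|y|² for all y ∈ Y, and let K = ĈH*(HĈH* + Γ)^{-1}. Then (I_U + ĈH*Γ^{-1}H)(I_U − KH) = I_U, and consequently, for any v̂ ∈ U and y ∈ Y, the vector v̄ = v̂ + K(y − Hv̂) satisfies (I_U + ĈH*Γ^{-1}H)v̄ = v̂ + ĈH*Γ^{-1}y. -/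
open scoped RealInnerProductSpace
open ContinuousLinearMap

theorem isUnit_of_coercive_aux {Y : Type*} [NormedAddCommGroup Y] [InnerProductSpace ℝ Y]
    [CompleteSpace Y] (A : Y →L[ℝ] Y) (c : ℝ) (hc : 0 < c)
    (h : ∀ y : Y, c * ‖y‖ ^ 2 ≤ ⟪y, A y⟫) : IsUnit A := by
  have hB : IsCoercive ((innerSL ℝ : Y →L[ℝ] Y →L[ℝ] ℝ) ∘L A) := by
    refine ⟨c, hc, fun u => ?_⟩
    have := h u
    rw [real_inner_comm] at this
    change c * ‖u‖ * ‖u‖ ≤ ⟪A u, u⟫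
    nlinarith [this]
  have he : (hB.continuousLinearEquivOfBilin : Y →L[ℝ] Y) = A := by
    ext v
    refine ext_inner_right ℝ fun w => ?_
    exact hB.continuousLinearEquivOfBilin_apply v w
  rw [← he]
  exact ⟨ContinuousLinearEquiv.unitsEquiv ℝ Y |>.symm hB.continuousLinearEquivOfBilin, rfl⟩

/-- Lemma 2.3, equation (2.6): with `K = ĈH*(HĈH* + Γ)⁻¹`,
one has `(I + ĈH*Γ⁻¹H)(I − KH) = I`, and consequently the analysis mean
`v̄ = v̂ + K(y − Hv̂)` satisfies `(I + ĈH*Γ⁻¹H)v̄ = v̂ + ĈH*Γ⁻¹y`. -/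
theorem stmt2 {U Y : Type*} [NormedAddCommGroup U] [InnerProductSpace ℝ U] [CompleteSpace U]
    [NormedAddCommGroup Y] [InnerProductSpace ℝ Y] [CompleteSpace Y]
    (H : U →L[ℝ] Y)
    (Ch : U →L[ℝ] U) (hChsa : IsSelfAdjoint Ch) (hChpos : ∀ u : U, 0 ≤ ⟪u, Ch u⟫)
    (Γ : Y →L[ℝ] Y) (hΓsa : IsSelfAdjoint Γ)
    (c : ℝ) (hc : 0 < c) (hΓpos : ∀ y : Y, c * ‖y‖ ^ 2 ≤ ⟪y, Γ y⟫)
    (K : Y →L[ℝ] U)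
    (hK : K = Ch ∘L adjoint H ∘L Ring.inverse (H ∘L Ch ∘L adjoint H + Γ)) :
    (1 + Ch ∘L adjoint H ∘L Ring.inverse Γ ∘L H) ∘L (1 - K ∘L H) = 1 ∧
    ∀ (vh : U) (y : Y),
      (1 + Ch ∘L adjoint H ∘L Ring.inverse Γ ∘L H) (vh + K (y - H vh))
        = vh + (Ch ∘L adjoint H ∘L Ring.inverse Γ) y := by
  have uΓ : IsUnit Γ := isUnit_of_coercive_aux Γ c hc hΓpos
  have uS : IsUnit (H ∘L Ch ∘L adjoint H + Γ) := by
    refine isUnit_of_coercive_aux _ c hc fun y => ?_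
    have h1 := hChpos (adjoint H y)
    rw [adjoint_inner_left] at h1
    have h2 := hΓpos y
    simp only [add_apply, comp_apply, inner_add_right]
    linarith
  have key : ∀ z : Y, K z + Ch (adjoint H (Ring.inverse Γ (H (K z))))
      = Ch (adjoint H (Ring.inverse Γ z)) := by
    intro z
    have h1 := congrArg (fun T : Y →L[ℝ] Y => T z) (Ring.mul_inverse_cancel _ uS)
    have hKz : K z = Ch (adjoint H (Ring.inverse (H ∘L Ch ∘L adjoint H + Γ) z)) := by
      rw [hK]; rfl
    generalize Ring.inverse (H ∘L Ch ∘L adjoint H + Γ) = R at h1 hKz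
    have h2 : H (K z) + Γ (R z) = z := by
      rw [hKz]; exact h1
    have h3 : Ring.inverse Γ (Γ (R z)) = R z :=
      congrArg (fun T : Y →L[ℝ] Y => T (R z)) (Ring.inverse_mul_cancel _ uΓ)
    have h4 : Ring.inverse Γ (H (K z)) + R z = Ring.inverse Γ z := by
      conv_rhs => rw [← h2, map_add, h3]
    rw [← h4, map_add, map_add, ← hKz, add_comm]
  constructor
  · ext u
    have := key (H u)
    simp only [comp_apply, add_apply, sub_apply, one_apply_eq_self, map_sub]
    rw [← this]
    abel
  · intro vh y
    have := key (y - H vh)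
    simp only [comp_apply, add_apply, one_apply_eq_self, map_add]
    rw [this]
    simp only [map_sub]
    abel
end

section
/- Let U and Y be real Hilbert spaces, H : U → Y a bounded linear operator, Γ : Y → Y a bounded self-adjoint operator that is positive definite in the sense that there exists c > 0 with ⟨y, Γy⟩ ≥ c|y|² for all y ∈ Y, and let N ≥ 2 and V̂ = (v̂^(1), …, v̂^(N)) ∈ U^N be an ensemble with deviations dV̂ and covariance Ĉ = cov(V̂). Then the N×N real matrix S^{-1} := I_N + (1/(N−1))·dV̂*H*Γ^{-1}H·dV̂, whose (i,j) entry is δ_{ij} + (1/(N−1))⟨H(v̂^(i) − v̄̂), Γ^{-1}H(v̂^(j) − v̄̂)⟩, is symmetric positive definite, and its positive-definite inverse square root T = (S^{-1})^{-1/2} is a symmetric matrix satisfying (1/(N−1))·(dV̂T)(dV̂T)* = (I_U − KH)Ĉ, where K = ĈH*(HĈH* + Γ)^{-1} and dV̂T denotes the ensemble with n-th member ∑_{k=1}^N (v̂^(k) − v̄̂)T_{kn}. -/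
open scoped RealInnerProductSpace
open ContinuousLinearMap

/-- The rank-one operator `u ⊗ v : w ↦ ⟨v, w⟩ u` on a real Hilbert space. -/
noncomputable def rankOne {U : Type*} [NormedAddCommGroup U] [InnerProductSpace ℝ U]
    (u v : U) : U →L[ℝ] U :=
  (innerSL ℝ v).smulRight u

theorem inverse_apply_aux {Y : Type*} [NormedAddCommGroup Y] [InnerProductSpace ℝ Y]
    (A : Y →L[ℝ] Y) (h : IsUnit A) (y : Y) : A (Ring.inverse A y) = y := by
  have := congrArg (fun B : Y →L[ℝ] Y => B y) (Ring.mul_inverse_cancel A h)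
  simpa using this

theorem inverse_apply_aux2 {Y : Type*} [NormedAddCommGroup Y] [InnerProductSpace ℝ Y]
    (A : Y →L[ℝ] Y) (h : IsUnit A) (y : Y) : Ring.inverse A (A y) = y := by
  have := congrArg (fun B : Y →L[ℝ] Y => B y) (Ring.inverse_mul_cancel A h)
  simpa using this

open scoped MatrixOrder in
theorem exists_inv_sqrt_aux {N : ℕ} (S : Matrix (Fin N) (Fin N) ℝ) (hS : S.PosDef) :
    ∃ T : Matrix (Fin N) (Fin N) ℝ, T.PosDef ∧ T * T * S = 1 := by
  have hi := hS.inv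
  have hsq : CFC.sqrt S⁻¹ * CFC.sqrt S⁻¹ = S⁻¹ :=
    CFC.sqrt_mul_sqrt_self _ hi.posSemidef.nonneg
  have h1 : CFC.sqrt S⁻¹ * CFC.sqrt S⁻¹ * S = 1 := by
    rw [hsq]
    exact Matrix.nonsing_inv_mul _ ((Matrix.isUnit_iff_isUnit_det _).1 hS.isUnit)
  refine ⟨CFC.sqrt S⁻¹, ?_, h1⟩
  have hu : IsUnit (CFC.sqrt S⁻¹) := by
    rw [mul_assoc] at h1
    exact IsUnit.of_mul_eq_one _ h1
  exact (Matrix.PosSemidef.posDef_iff_isUnit (Matrix.nonneg_iff_posSemidef.1 (CFC.sqrt_nonneg S⁻¹))).2 hu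

/-- Theorem 2.4, well-definedness of the ETKF transform: the matrix
`S⁻¹ = I_N + (N−1)⁻¹ dV̂*H*Γ⁻¹H dV̂` is symmetric positive definite, its
positive-definite inverse square root `T` (characterized by `T` positive definite with
`T·T·S⁻¹ = I`) exists, is symmetric, and satisfies
`(N−1)⁻¹ (dV̂T)(dV̂T)* = (I − KH)Ĉ` where `K` is the Kalman gain. -/
theorem stmt3 {U Y : Type*} [NormedAddCommGroup U] [InnerProductSpace ℝ U] [CompleteSpace U]
    [NormedAddCommGroup Y] [InnerProductSpace ℝ Y] [CompleteSpace Y]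
    (H : U →L[ℝ] Y)
    (Γ : Y →L[ℝ] Y) (hΓsa : IsSelfAdjoint Γ)
    (c : ℝ) (hc : 0 < c) (hΓpos : ∀ y : Y, c * ‖y‖ ^ 2 ≤ ⟪y, Γ y⟫)
    (N : ℕ) (hN : 2 ≤ N) (Vh : Fin N → U)
    (vhbar : U) (hvhbar : vhbar = (N : ℝ)⁻¹ • ∑ n, Vh n)
    (dV : Fin N → U) (hdV : ∀ n, dV n = Vh n - vhbar)
    (Ch : U →L[ℝ] U) (hCh : Ch = ((N : ℝ) - 1)⁻¹ • ∑ n, rankOne (dV n) (dV n))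
    (K : Y →L[ℝ] U)
    (hK : K = Ch ∘L adjoint H ∘L Ring.inverse (H ∘L Ch ∘L adjoint H + Γ))
    (Sinv : Matrix (Fin N) (Fin N) ℝ)
    (hSinv : Sinv = 1 + Matrix.of fun i j =>
      ((N : ℝ) - 1)⁻¹ * ⟪H (dV i), Ring.inverse Γ (H (dV j))⟫) :
    Sinv.PosDef ∧
    (∃ T : Matrix (Fin N) (Fin N) ℝ, T.PosDef ∧ T * T * Sinv = 1) ∧
    ∀ T : Matrix (Fin N) (Fin N) ℝ, T.PosDef → T * T * Sinv = 1 →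
      T.IsSymm ∧
      ((N : ℝ) - 1)⁻¹ • ∑ n, rankOne (∑ k, T k n • dV k) (∑ k, T k n • dV k)
        = (1 - K ∘L H) ∘L Ch := by
  have ha : 0 < ((N : ℝ) - 1)⁻¹ := by
    have : (2 : ℝ) ≤ N := by exact_mod_cast hN
    exact inv_pos.2 (by linarith)
  clear hdV hvhbar hN
  generalize ((N : ℝ) - 1)⁻¹ = a at *
  have hΓu := isUnit_of_coercive_aux Γ c hc hΓpos
  have hsym : ∀ x y : Y, ⟪Γ x, y⟫ = ⟪x, Γ y⟫ := fun x y => hΓsa.isSymmetric x y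
  have hG := inverse_apply_aux Γ hΓu
  have hG2 := inverse_apply_aux2 Γ hΓu
  generalize Ring.inverse Γ = G at *
  have hGsym : ∀ x y : Y, ⟪G x, y⟫ = ⟪x, G y⟫ := fun x y => by
    rw [← hG y, ← hsym, hG, hG2]
  have hGpos : ∀ x : Y, 0 ≤ ⟪x, G x⟫ := fun x => by
    have h := hΓpos (G x)
    rw [hG, real_inner_comm] at h
    exact le_trans (by positivity) h
  have hChap : ∀ w, Ch w = a • ∑ n, ⟪dV n, w⟫ • dV n := fun w => by
    simp [hCh, rankOne]
  have hChpos : ∀ w, 0 ≤ ⟪w, Ch w⟫ := fun w => by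
    rw [hChap, inner_smul_right, inner_sum]
    refine mul_nonneg ha.le (Finset.sum_nonneg fun n _ => ?_)
    rw [inner_smul_right, real_inner_comm]
    exact mul_self_nonneg _
  have hMu : IsUnit (H ∘L Ch ∘L adjoint H + Γ) := by
    refine isUnit_of_coercive_aux _ c hc fun y => ?_
    have h := hChpos (adjoint H y)
    rw [adjoint_inner_left] at h
    simp only [add_apply, comp_apply, inner_add_right]
    linarith [hΓpos y]
  have hPD : Sinv.PosDef := by
    rw [hSinv]
    refine Matrix.PosDef.one.add_posSemidef ?_
    refine Matrix.PosSemidef.of_dotProduct_mulVec_nonneg ?_ fun x => ?_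
    · ext i j
      simp only [Matrix.conjTranspose_apply, Matrix.of_apply, star_trivial]
      rw [← hGsym, real_inner_comm]
    · have h := mul_nonneg ha.le (hGpos (∑ i, x i • H (dV i)))
      convert h using 1
      simp only [dotProduct, Matrix.mulVec, Matrix.of_apply, star_trivial, map_sum, map_smul,
        sum_inner, inner_sum, inner_smul_left, inner_smul_right, Finset.mul_sum]
      refine Finset.sum_congr rfl fun i _ => Finset.sum_congr rfl fun j _ => ?_
      rw [← hGsym (H (dV j)), real_inner_comm (H (dV i))]
      simp
      ring
  refine ⟨hPD, exists_inv_sqrt_aux _ hPD, fun T hT hTS => ?_⟩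
  have hTs : T.IsSymm := by
    have := hT.isHermitian
    rwa [Matrix.IsHermitian, Matrix.conjTranspose_eq_transpose_of_trivial] at this
  refine ⟨hTs, ?_⟩
  ext w
  obtain ⟨y, hy⟩ : ∃ y, y = Ring.inverse (H ∘L Ch ∘L adjoint H + Γ) (H (Ch w)) := ⟨_, rfl⟩
  have hMy := inverse_apply_aux _ hMu (H (Ch w))
  rw [← hy] at hMy
  simp only [add_apply, comp_apply] at hMy
  obtain ⟨u, hu⟩ : ∃ u, u = w - adjoint H y := ⟨_, rfl⟩
  have hyG : y = G (H (Ch u)) := by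
    have : Γ y = H (Ch u) := by
      rw [hu, map_sub, map_sub, ← hMy]; abel
    rw [← this, hG2]
  have hR : ((1 - K ∘L H) ∘L Ch) w = Ch u := by
    simp [hK, hu, hy]
  have hr : (fun l => ⟪dV l, w⟫) = Sinv.mulVec (fun l => ⟪dV l, u⟫) := by
    funext l
    have hw : w = u + adjoint H y := by rw [hu]; abel
    conv_lhs => rw [hw]
    rw [inner_add_right, adjoint_inner_right, hyG, hChap, hSinv, Matrix.add_mulVec,
      Matrix.one_mulVec, Pi.add_apply]
    congr 1
    simp only [map_smul, map_sum, inner_smul_right, inner_sum, Matrix.mulVec, dotProduct,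
      Matrix.of_apply, Finset.mul_sum]
    refine Finset.sum_congr rfl fun j _ => ?_
    ring
  have hb : ∀ k, ⟪dV k, u⟫ = ∑ l, (T * T) k l * ⟪dV l, w⟫ := fun k => by
    have : (T * T).mulVec (fun l => ⟪dV l, w⟫) = (fun l => ⟪dV l, u⟫) := by
      rw [hr, Matrix.mulVec_mulVec, hTS, Matrix.one_mulVec]
    exact (congrFun this k).symm
  rw [hR, hChap]
  have hTs' : ∀ i j, T i j = T j i := fun i j => hTs.apply j i
  have hL : (a • ∑ n, rankOne (∑ k, T k n • dV k) (∑ k, T k n • dV k)) w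
      = a • ∑ n, (∑ l, T l n * ⟪dV l, w⟫) • ∑ k, T k n • dV k := by
    simp [rankOne, sum_inner, inner_smul_left]
  rw [hL]
  congr 1
  simp only [hb, Finset.smul_sum, smul_smul]
  rw [Finset.sum_comm]
  refine Finset.sum_congr rfl fun k _ => ?_
  rw [← Finset.sum_smul]
  congr 1
  simp only [Matrix.mul_apply, Finset.sum_mul]
  rw [Finset.sum_comm]
  refine Finset.sum_congr rfl fun l _ => Finset.sum_congr rfl fun n _ => ?_
  rw [hTs' n l]
  ring
end

section
/- Let U and Y be real Hilbert spaces, H : U → Y a bounded linear operator, Γ : Y → Y a bounded self-adjoint operator that is positive definite in the sense that there exists c > 0 with ⟨y, Γy⟩ ≥ c|y|² for all y ∈ Y, N ≥ 2, and dV̂ = (d^(1), …, d^(N)) ∈ U^N a tuple with ∑_{n=1}^N d^(n) = 0. Set Ĉ = (1/(N−1))∑_{n=1}^N d^(n) ⊗ d^(n). Then the N×N matrix I_N + (1/(N−1))·dV̂*H*Γ^{-1}H·dV̂ is invertible and (1/(N−1))·dV̂·(I_N + (1/(N−1))·dV̂*H*Γ^{-1}H·dV̂)^{-1}·dV̂*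 = Ĉ − ĈH*(Γ + HĈH*)^{-1}HĈ. -/
open scoped RealInnerProductSpace
open ContinuousLinearMap

theorem aux_unit {Y : Type*}
    [NormedAddCommGroup Y] [InnerProductSpace ℝ Y] [CompleteSpace Y]
    (Γ : Y →L[ℝ] Y) (c : ℝ) (hc : 0 < c) (hΓpos : ∀ y : Y, c * ‖y‖ ^ 2 ≤ ⟪y, Γ y⟫) :
    IsUnit Γ := by
  refine ContinuousLinearMap.isUnit_of_forall_le_norm_inner_map Γ (c := ⟨c, hc.le⟩) hc ?_
  intro y
  rw [real_inner_comm]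
  refine le_trans ?_ (le_abs_self _)
  have := hΓpos y
  rw [mul_comm] at this
  exact this

/-- covariance update identity, cf. (2.11) and Lemma A.2: for
deviations `dV̂ = (d⁽¹⁾, …, d⁽ᴺ⁾)` summing to zero, with
`Ĉ = (N−1)⁻¹ ∑ d⁽ⁿ⁾ ⊗ d⁽ⁿ⁾`, the matrix `I_N + (N−1)⁻¹ dV̂*H*Γ⁻¹H dV̂` is invertible
and `(N−1)⁻¹ dV̂ (I_N + (N−1)⁻¹ dV̂*H*Γ⁻¹H dV̂)⁻¹ dV̂* = Ĉ − ĈH*(Γ + HĈH*)⁻¹HĈ`. -/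
theorem stmt4 {U Y : Type*} [NormedAddCommGroup U] [InnerProductSpace ℝ U] [CompleteSpace U]
    [NormedAddCommGroup Y] [InnerProductSpace ℝ Y] [CompleteSpace Y]
    (H : U →L[ℝ] Y)
    (Γ : Y →L[ℝ] Y) (hΓsa : IsSelfAdjoint Γ)
    (c : ℝ) (hc : 0 < c) (hΓpos : ∀ y : Y, c * ‖y‖ ^ 2 ≤ ⟪y, Γ y⟫)
    (N : ℕ) (hN : 2 ≤ N) (dV : Fin N → U) (hsum : ∑ n, dV n = 0)
    (Ch : U →L[ℝ] U) (hCh : Ch = ((N : ℝ) - 1)⁻¹ • ∑ n, rankOne (dV n) (dV n))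
    (M : Matrix (Fin N) (Fin N) ℝ)
    (hM : M = 1 + Matrix.of fun i j =>
      ((N : ℝ) - 1)⁻¹ * ⟪H (dV i), Ring.inverse Γ (H (dV j))⟫) :
    IsUnit M ∧
    ((N : ℝ) - 1)⁻¹ • (∑ i, ∑ j, M⁻¹ i j • rankOne (dV i) (dV j))
      = Ch - Ch ∘L adjoint H ∘L Ring.inverse (Γ + H ∘L Ch ∘L adjoint H) ∘L H ∘L Ch := by
  have hs : (0:ℝ) ≤ ((N : ℝ) - 1)⁻¹ := by
    have : (2:ℝ) ≤ N := by exact_mod_cast hN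
    exact inv_nonneg.mpr (by linarith)
  generalize ((N : ℝ) - 1)⁻¹ = s at *
  have hCw : ∀ w, Ch w = s • ∑ i, ⟪dV i, w⟫ • dV i := by
    intro w
    simp [hCh, rankOne, ContinuousLinearMap.sum_apply]
  have hCpos : ∀ w, 0 ≤ ⟪w, Ch w⟫ := by
    intro w
    rw [hCw, real_inner_smul_right, inner_sum]
    refine mul_nonneg hs (Finset.sum_nonneg fun i _ => ?_)
    rw [real_inner_smul_right, real_inner_comm]
    exact mul_self_nonneg _
  have hΓu := aux_unit Γ c hc hΓpos
  have hKu : IsUnit (Γ + H ∘L Ch ∘L adjoint H) := by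
    refine aux_unit _ c hc fun y => ?_
    have h1 := hCpos (adjoint H y)
    rw [ContinuousLinearMap.adjoint_inner_left] at h1
    have h2 := hΓpos y
    simp only [ContinuousLinearMap.add_apply, ContinuousLinearMap.comp_apply, inner_add_right]
    linarith
  have hG1 : ∀ y, Γ (Ring.inverse Γ y) = y := fun y => by
    have := congrArg (fun A : Y →L[ℝ] Y => A y) (Ring.mul_inverse_cancel Γ hΓu)
    simpa using this
  have hG2 : ∀ y, Ring.inverse Γ (Γ y) = y := fun y => by
    have := congrArg (fun A : Y →L[ℝ] Y => A y) (Ring.inverse_mul_cancel Γ hΓu)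
    simpa using this
  have hK1 : ∀ y, (Γ + H ∘L Ch ∘L adjoint H)
      (Ring.inverse (Γ + H ∘L Ch ∘L adjoint H) y) = y := fun y => by
    have := congrArg (fun A : Y →L[ℝ] Y => A y) (Ring.mul_inverse_cancel _ hKu)
    simpa only [ContinuousLinearMap.mul_apply, ContinuousLinearMap.one_apply] using this
  generalize Ring.inverse (Γ + H ∘L Ch ∘L adjoint H) = R at *
  generalize Ring.inverse Γ = G at *
  have hGpos : ∀ y, 0 ≤ ⟪y, G y⟫ := fun y => by
    have h1 := hΓpos (G y)
    rw [hG1, real_inner_comm] at h1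
    exact le_trans (by positivity) h1
  have hMv : ∀ v i, M.mulVec v i = v i + ⟪H (dV i), G (H (s • ∑ j, v j • dV j))⟫ := by
    intro v i
    rw [hM, Matrix.add_mulVec, Matrix.one_mulVec]
    simp only [Pi.add_apply, Matrix.mulVec, dotProduct, Matrix.of_apply, map_smul, map_sum,
      inner_sum, real_inner_smul_right, Finset.mul_sum]
    congr 1
    refine Finset.sum_congr rfl fun j _ => ?_
    ring
  have hMu : IsUnit M := by
    rw [← Matrix.mulVec_injective_iff_isUnit]
    refine (injective_iff_map_eq_zero (Matrix.mulVecLin M)).2 ?_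
    intro v hv
    have h0 : ∀ i, v i + ⟪H (dV i), G (H (s • ∑ j, v j • dV j))⟫ = 0 := fun i => by
      rw [← hMv]; exact congrFun hv i
    set x := ∑ j, v j • dV j with hx
    have h1 : ∑ i, v i * v i + ⟪H x, G (H (s • x))⟫ = 0 := by
      have : ⟪H x, G (H (s • x))⟫ = ∑ i, v i * ⟪H (dV i), G (H (s • x))⟫ := by
        conv_lhs => rw [hx, map_sum, sum_inner]
        simp only [map_smul, real_inner_smul_left, hx]
      rw [this, ← Finset.sum_add_distrib]
      refine Finset.sum_eq_zero fun i _ => ?_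
      rw [← mul_add, h0, mul_zero]
    have h2 : 0 ≤ ⟪H x, G (H (s • x))⟫ := by
      simp only [map_smul, real_inner_smul_right]
      exact mul_nonneg hs (hGpos _)
    have h3 : ∑ i, v i * v i = 0 :=
      le_antisymm (by linarith) (Finset.sum_nonneg fun i _ => mul_self_nonneg _)
    funext i
    have := (Finset.sum_eq_zero_iff_of_nonneg (fun i _ => mul_self_nonneg (v i))).1 h3 i
      (Finset.mem_univ i)
    simpa using this
  refine ⟨hMu, ?_⟩
  ext w
  set q := R (H (Ch w)) with hq
  have hKq := hK1 (H (Ch w))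
  rw [← hq] at hKq
  simp only [ContinuousLinearMap.add_apply, ContinuousLinearMap.comp_apply] at hKq
  have hr : (Ch - Ch ∘L adjoint H ∘L R ∘L H ∘L Ch) w = Ch (w - adjoint H q) := by
    simp [hq]
  have key : M.mulVec (fun i => ⟪dV i, w - adjoint H q⟫) = fun i => ⟪dV i, w⟫ := by
    funext i
    rw [hMv, ← hCw]
    have : H (Ch (w - adjoint H q)) = Γ q := by
      rw [map_sub, map_sub, ← hKq]; abel
    rw [this, hG2, inner_sub_right, ContinuousLinearMap.adjoint_inner_right]
    ring
  have key2 : M⁻¹.mulVec (fun i => ⟪dV i, w⟫) = (fun i => ⟪dV i, w - adjoint H q⟫) := by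
    rw [← key, Matrix.mulVec_mulVec,
      Matrix.nonsing_inv_mul _ ((Matrix.isUnit_iff_isUnit_det M).1 hMu), Matrix.one_mulVec]
  rw [hr, hCw]
  simp only [ContinuousLinearMap.smul_apply, ContinuousLinearMap.sum_apply]
  congr 1
  refine Finset.sum_congr rfl fun i _ => ?_
  rw [← congrFun key2 i]
  simp [Matrix.mulVec, dotProduct, rankOne, Finset.sum_smul, smul_smul]
end

section
/- Let U and Y be real Hilbert spaces, H : U → Y a bounded linear operator, Γ : Y → Y a bounded self-adjoint operator that is positive definite in the sense that there exists c > 0 with ⟨y, Γy⟩ ≥ c|y|² for all y ∈ Y, N ≥ 2, and dV̂ = (d^(1), …, d^(N)) ∈ U^N a tuple with ∑_{n=1}^N d^(n) = 0. Let S^{-1} = I_N + (1/(N−1))·dV̂*H*Γ^{-1}H·dV̂ (a symmetric positive definite N×N matrix) and let T = (S^{-1})^{-1/2} be its positive-definite inverse square root. Then T𝟙 = 𝟙, where 𝟙 = (1, …, 1)ᵀ ∈ ℝ^N. -/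
open scoped RealInnerProductSpace

/-- Lemma 2.5, equation (2.8): if the deviations `d⁽¹⁾, …, d⁽ᴺ⁾` sum to
zero, then the positive-definite inverse square root `T` of the symmetric positive definite
matrix `S⁻¹ = I_N + (N−1)⁻¹ dV̂*H*Γ⁻¹H dV̂` (characterized by `T` positive definite with
`T·T·S⁻¹ = I`) fixes the all-ones vector: `T𝟙 = 𝟙`. -/
theorem stmt5 {U Y : Type*} [NormedAddCommGroup U] [InnerProductSpace ℝ U] [CompleteSpace U]
    [NormedAddCommGroup Y] [InnerProductSpace ℝ Y] [CompleteSpace Y]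
    (H : U →L[ℝ] Y)
    (Γ : Y →L[ℝ] Y) (hΓsa : IsSelfAdjoint Γ)
    (c : ℝ) (hc : 0 < c) (hΓpos : ∀ y : Y, c * ‖y‖ ^ 2 ≤ ⟪y, Γ y⟫)
    (N : ℕ) (hN : 2 ≤ N) (dV : Fin N → U) (hsum : ∑ n, dV n = 0)
    (Sinv : Matrix (Fin N) (Fin N) ℝ)
    (hSinv : Sinv = 1 + Matrix.of fun i j =>
      ((N : ℝ) - 1)⁻¹ * ⟪H (dV i), Ring.inverse Γ (H (dV j))⟫)
    (T : Matrix (Fin N) (Fin N) ℝ) (hTpd : T.PosDef) (hT : T * T * Sinv = 1) :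
    T.mulVec (fun _ => 1) = fun _ => 1 := by
  have h1 : Sinv.mulVec (fun _ => 1) = fun _ => 1 := by
    rw [hSinv, Matrix.add_mulVec, Matrix.one_mulVec]
    funext i
    simp only [Pi.add_apply, Matrix.mulVec, dotProduct, Matrix.of_apply, mul_one]
    rw [← Finset.mul_sum, ← inner_sum, ← map_sum, ← map_sum, hsum]
    simp
  have h2 : T.mulVec (T.mulVec (fun _ => 1)) = fun _ => 1 := by
    have h := congrArg (fun M : Matrix (Fin N) (Fin N) ℝ => M.mulVec (fun _ => 1)) hT
    simp only [← Matrix.mulVec_mulVec, h1, Matrix.one_mulVec] at h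
    exact h
  by_contra hne
  have hw : T.mulVec (fun _ => 1) - (fun _ => 1) ≠ 0 := sub_ne_zero.mpr hne
  have hp := hTpd.dotProduct_mulVec_pos hw
  rw [Matrix.mulVec_sub, h2, ← neg_sub (T.mulVec (fun _ => 1)) (fun _ => 1), dotProduct_neg, star_trivial] at hp
  have hq : 0 ≤ dotProduct (T.mulVec (fun _ => 1) - (fun _ => 1)) (T.mulVec (fun _ => 1) - (fun _ => 1)) :=
    Finset.sum_nonneg fun i _ => mul_self_nonneg _
  linarith
end

section
/- Let U be a real Hilbert space, N ≥ 2, γ > 0, and let Ê = (ê^(1), …, ê^(N)) ∈ U^N and V̂ = (v̂^(1), …, v̂^(N)) ∈ U^N be ensembles with the same deviations, i.e., ê^(n) − ē̂ = v̂^(n) − v̄̂ for all n, where ē̂ and v̄̂ are the respective means. Let Ĉ = cov(V̂), J = I_U + γ^{-2}Ĉ, and T = (I_N + (γ^{-2}/(N−1))·dV̂*dV̂)^{-1/2} (the positive-definite inverse square root). Then the ensemble R₁ = J^{-1}ÊT^{-1}, whose n-th member is J^{-1}∑_{k=1}^N ê^(k)(T^{-1})_{kn}, satisfies ‖R₁‖²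 ≤ ‖Ê‖², where ‖·‖ is the ensemble ℓ²-norm. -/
open scoped RealInnerProductSpace

/-- key estimate (3.7) in Theorem 3.4: for ensembles `Ê` and `V̂`
with the same deviations, `J = I + γ⁻²Ĉ` with `Ĉ = cov(V̂)`, and `T` the
positive-definite inverse square root of `I_N + (γ⁻²/(N−1)) dV̂*dV̂`, the ensemble
`R₁ = J⁻¹ Ê T⁻¹` satisfies `‖R₁‖ₑ² ≤ ‖Ê‖ₑ²` in the ensemble ℓ²-norm. -/
theorem stmt8 {U : Type*} [NormedAddCommGroup U] [InnerProductSpace ℝ U] [CompleteSpace U]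
    (N : ℕ) (hN : 2 ≤ N) (γ : ℝ) (hγ : 0 < γ)
    (Eh Vh : Fin N → U)
    (Ebar : U) (hEbar : Ebar = (N : ℝ)⁻¹ • ∑ n, Eh n)
    (vhbar : U) (hvhbar : vhbar = (N : ℝ)⁻¹ • ∑ n, Vh n)
    (hdev : ∀ n, Eh n - Ebar = Vh n - vhbar)
    (dV : Fin N → U) (hdV : ∀ n, dV n = Vh n - vhbar)
    (Ch : U →L[ℝ] U) (hCh : Ch = ((N : ℝ) - 1)⁻¹ • ∑ n, rankOne (dV n) (dV n))
    (J : U →L[ℝ] U) (hJ : J = 1 + (γ ^ 2)⁻¹ • Ch)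
    (T : Matrix (Fin N) (Fin N) ℝ) (hTpd : T.PosDef)
    (hT : T * T * (1 + Matrix.of fun i j =>
      (γ ^ 2)⁻¹ * ((N : ℝ) - 1)⁻¹ * ⟪dV i, dV j⟫) = 1)
    (R1 : Fin N → U)
    (hR1 : ∀ n, R1 n = Ring.inverse J (∑ k, T⁻¹ k n • Eh k)) :
    (N : ℝ)⁻¹ * ∑ n, ‖R1 n‖ ^ 2 ≤ (N : ℝ)⁻¹ * ∑ n, ‖Eh n‖ ^ 2 := by
  have hN0 : (0 : ℝ) < N := by
    have : 0 < N := by omega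
    exact_mod_cast this
  have hN1 : (0 : ℝ) ≤ (N : ℝ) - 1 := by
    have : (2 : ℝ) ≤ N := by exact_mod_cast hN
    linarith
  apply mul_le_mul_of_nonneg_left _ (inv_nonneg.mpr hN0.le)
  by_cases hu : IsUnit J
  swap
  · simp only [hR1, Ring.inverse_non_unit _ hu]
    simp only [ContinuousLinearMap.zero_apply, norm_zero]
    apply Finset.sum_le_sum
    intro n _
    nlinarith [sq_nonneg ‖Eh n‖]
  set K := Ring.inverse J with hK
  have hJK : J * K = 1 := Ring.mul_inverse_cancel _ hu
  have hKJ : K * J = 1 := Ring.inverse_mul_cancel _ hu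
  set c : ℝ := (γ ^ 2)⁻¹ * ((N : ℝ) - 1)⁻¹ with hc
  have hc0 : 0 ≤ c := by positivity
  have hJx : ∀ x, J x = x + c • ∑ l, ⟪dV l, x⟫ • dV l := by
    intro x
    rw [hJ, hCh]
    simp [rankOne, smul_smul, hc]
  have hd : ∀ n, Eh n = Ebar + dV n := by
    intro n
    rw [hdV, ← hdev]; abel
  have hsum : ∑ n, dV n = 0 := by
    have h1 : ∑ n, Eh n = (N : ℝ) • Ebar := by
      rw [hEbar, smul_smul, mul_inv_cancel₀ hN0.ne', one_smul]
    simp only [hd, Finset.sum_add_distrib] at h1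
    simpa [Nat.cast_smul_eq_nsmul] using h1
  have hKx : ∀ x, ‖K x‖ ≤ ‖x‖ := by
    intro x
    have e : J (K x) = x := by
      have := congrArg (fun f : U →L[ℝ] U => f x) hJK
      simpa using this
    have h1 : ‖K x‖ ^ 2 ≤ ⟪J (K x), K x⟫ := by
      rw [hJx, inner_add_left, real_inner_self_eq_norm_sq, real_inner_smul_left, sum_inner]
      have : 0 ≤ ∑ l, ⟪⟪dV l, K x⟫ • dV l, K x⟫ := by
        apply Finset.sum_nonneg
        intro l _
        rw [real_inner_smul_left]
        exact mul_self_nonneg _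
      nlinarith [mul_nonneg hc0 this]
    rw [e] at h1
    have h2 := real_inner_le_norm x (K x)
    by_contra! h3
    nlinarith [norm_nonneg x, norm_nonneg (K x)]
  have hpy : ∀ a : U, ∑ n, ‖a + dV n‖ ^ 2 = N * ‖a‖ ^ 2 + ∑ n, ‖dV n‖ ^ 2 := by
    intro a
    simp only [norm_add_sq_real, Finset.sum_add_distrib, ← Finset.mul_sum, ← inner_sum, hsum]
    simp
  -- the matrix part
  have hdet : IsUnit T.det := (Matrix.isUnit_iff_isUnit_det _).mp hTpd.isUnit
  have hSS : T⁻¹ * T⁻¹ = 1 + Matrix.of fun i j => c * ⟪dV i, dV j⟫ := by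
    rw [← Matrix.mul_inv_rev]
    exact Matrix.inv_eq_right_inv hT
  have hSsymm : ∀ i j, T⁻¹ i j = T⁻¹ j i := by
    intro i j
    have := hTpd.isHermitian.inv.apply i j
    simpa using this.symm
  have hKE : ∀ k, K (Eh k) + c • ∑ l, ⟪dV k, dV l⟫ • K (Eh l) = K Ebar + dV k := by
    intro k
    have e : K (J (dV k)) = dV k := by
      have := congrArg (fun f : U →L[ℝ] U => f (dV k)) hKJ
      simpa using this
    have h0 : ∑ l, ⟪dV k, dV l⟫ • Eh l = ∑ l, ⟪dV l, dV k⟫ • dV l := by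
      simp only [hd, smul_add, Finset.sum_add_distrib, ← Finset.sum_smul, ← inner_sum, hsum]
      simp [real_inner_comm]
    calc _ = K (Eh k + c • ∑ l, ⟪dV k, dV l⟫ • Eh l) := by simp [map_sum]
      _ = K (Ebar + J (dV k)) := by rw [h0, hJx, hd k, add_assoc]
      _ = _ := by rw [map_add, e]
  have hmain : ∑ n, ‖R1 n‖ ^ 2 = ∑ k, ⟪K (Eh k), K Ebar + dV k⟫ := by
    have h1 : ∀ n, ‖R1 n‖ ^ 2 = ∑ k, ∑ l, (T⁻¹ k n * T⁻¹ n l) * ⟪K (Eh k), K (Eh l)⟫ := by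
      intro n
      rw [hR1, map_sum, ← real_inner_self_eq_norm_sq, sum_inner]
      refine Finset.sum_congr rfl fun k _ => ?_
      rw [inner_sum]
      refine Finset.sum_congr rfl fun l _ => ?_
      rw [map_smul, map_smul, real_inner_smul_left, real_inner_smul_right, hSsymm n l]
      ring
    simp only [h1]
    rw [Finset.sum_comm]
    refine Finset.sum_congr rfl fun k _ => ?_
    rw [Finset.sum_comm, ← hKE k, inner_add_right, real_inner_smul_right, inner_sum]
    have h2 : ∀ l, ∑ n, (T⁻¹ k n * T⁻¹ n l) * ⟪K (Eh k), K (Eh l)⟫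
        = (if k = l then 1 else 0) * ⟪K (Eh k), K (Eh l)⟫
          + c * (⟪dV k, dV l⟫ * ⟪K (Eh k), K (Eh l)⟫) := by
      intro l
      rw [← Finset.sum_mul, ← Matrix.mul_apply, hSS, Matrix.add_apply, Matrix.one_apply,
        Matrix.of_apply]
      ring
    simp only [h2, Finset.sum_add_distrib, ← Finset.mul_sum, real_inner_smul_right]
    simp
  rw [hmain]
  have hb : ∀ k, ⟪K (Eh k), K Ebar + dV k⟫ ≤ (‖Eh k‖ ^ 2 + ‖K Ebar + dV k‖ ^ 2) / 2 := by
    intro k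
    have h1 := real_inner_le_norm (K (Eh k)) (K Ebar + dV k)
    have h2 := hKx (Eh k)
    nlinarith [sq_nonneg (‖Eh k‖ - ‖K Ebar + dV k‖), norm_nonneg (K Ebar + dV k)]
  have hE : ∑ n, ‖Eh n‖ ^ 2 = N * ‖Ebar‖ ^ 2 + ∑ n, ‖dV n‖ ^ 2 := by
    rw [← hpy]; simp only [hd]
  have hfin := Finset.sum_le_sum (fun k (_ : k ∈ Finset.univ) => hb k)
  rw [← Finset.sum_div, Finset.sum_add_distrib, hpy] at hfin
  have h3 : ‖K Ebar‖ ^ 2 ≤ ‖Ebar‖ ^ 2 := by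
    have := hKx Ebar
    gcongr
  nlinarith [mul_le_mul_of_nonneg_left h3 hN0.le]
end

section
/- Let U be a real Hilbert space, F : U → U, β > 0, ρ > 0, ε > 0, t > 0, and N ∈ ℕ. Suppose F is Lipschitz on B(ρ): |F(a) − F(b)| ≤ β|a − b| for all a, b ∈ B(ρ). Suppose u : [0, t] → U and v^(n) : [0, t] → U for n = 1, …, N are differentiable with u'(s) = F(u(s)), (v^(n))'(s) = F(v^(n)(s)), and u(s) ∈ B(ρ), v^(n)(s) ∈ B(ρ) for all s ∈ [0, t] and all n. Let v̄(s) = (1/N)∑_{n=1}^N v^(n)(s). Then |v̄(t) − u(t)|² ≤ e^{2(β+ε)t}(|v̄(0) − u(0)|² + D) − D, where D = 2β²ρ²/(2(β+ε)ε). -/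
open scoped RealInnerProductSpace

/-- Lemma 3.7: if `F` is `β`-Lipschitz on the ball `B(ρ)`, the truth
`u` and all ensemble members `v⁽ⁿ⁾` solve the ODE `w' = F(w)` staying in `B(ρ)`, then the
error of the ensemble mean `v̄ = (1/N)∑ v⁽ⁿ⁾` satisfies
`|v̄(t) − u(t)|² ≤ e^{2(β+ε)t}(|v̄(0) − u(0)|² + D) − D` with `D = 2β²ρ²/(2(β+ε)ε)`. -/
theorem stmt10 {U : Type*} [NormedAddCommGroup U] [InnerProductSpace ℝ U]
    (F : U → U) (β ρ ε t : ℝ) (hβ : 0 < β) (hρ : 0 < ρ) (hε : 0 < ε) (ht : 0 < t)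
    (N : ℕ) (hN : 1 ≤ N)
    (hF : ∀ a b : U, ‖a‖ ≤ ρ → ‖b‖ ≤ ρ → ‖F a - F b‖ ≤ β * ‖a - b‖)
    (u : ℝ → U) (v : Fin N → ℝ → U)
    (hu : ∀ s ∈ Set.Icc (0 : ℝ) t, HasDerivAt u (F (u s)) s)
    (hv : ∀ n, ∀ s ∈ Set.Icc (0 : ℝ) t, HasDerivAt (v n) (F (v n s)) s)
    (huB : ∀ s ∈ Set.Icc (0 : ℝ) t, ‖u s‖ ≤ ρ)
    (hvB : ∀ n, ∀ s ∈ Set.Icc (0 : ℝ) t, ‖v n s‖ ≤ ρ)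
    (vbar : ℝ → U) (hvbar : ∀ s, vbar s = (N : ℝ)⁻¹ • ∑ n, v n s) :
    ‖vbar t - u t‖ ^ 2
      ≤ Real.exp (2 * (β + ε) * t) * (‖vbar 0 - u 0‖ ^ 2 + 2 * β ^ 2 * ρ ^ 2 / (2 * (β + ε) * ε))
        - 2 * β ^ 2 * ρ ^ 2 / (2 * (β + ε) * ε) := by
  have hN0 : (0 : ℝ) < N := by exact_mod_cast hN
  have avg : ∀ (w : Fin N → U) (c : ℝ), (∀ n, ‖w n‖ ≤ c) → ‖(N : ℝ)⁻¹ • ∑ n, w n‖ ≤ c := by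
    intro w c hw
    have h1 : ‖∑ n, w n‖ ≤ N * c := by
      refine (norm_sum_le_of_le _ (fun n _ => hw n)).trans ?_
      simp
    rw [norm_smul, Real.norm_of_nonneg (by positivity), inv_mul_le_iff₀ hN0]
    exact h1
  set D : ℝ := 2 * β ^ 2 * ρ ^ 2 / (2 * (β + ε) * ε) with hD
  set k : ℝ := 2 * (β + ε) with hk
  have hkD : k * D * ε = 2 * β ^ 2 * ρ ^ 2 := by
    rw [hD, hk]
    have : β + ε ≠ 0 := by positivity
    field_simp
  have hvb : vbar = fun s => (N : ℝ)⁻¹ • ∑ n, v n s := funext hvbar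
  let d : ℝ → U := fun s => (N : ℝ)⁻¹ • ∑ n, F (v n s) - F (u s)
  have he : ∀ s ∈ Set.Icc (0 : ℝ) t, HasDerivAt (fun s => vbar s - u s) (d s) s := by
    intro s hs
    rw [hvb]
    exact ((HasDerivAt.fun_sum (fun n _ => hv n s hs)).const_smul _).sub (hu s hs)
  have key : ∀ s ∈ Set.Icc (0 : ℝ) t,
      2 * inner ℝ (vbar s - u s) (d s) ≤ k * (‖vbar s - u s‖ ^ 2 + D) := by
    intro s hs
    have hb : ‖vbar s‖ ≤ ρ := by
      rw [hvbar]
      exact avg _ _ (fun n => hvB n s hs)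
    have hR : ‖(N : ℝ)⁻¹ • ∑ n, (F (v n s) - F (vbar s))‖ ≤ 2 * β * ρ := by
      apply avg
      intro n
      have h1 := hF _ _ (hvB n s hs) hb
      have h2 := norm_sub_le (v n s) (vbar s)
      have h3 := hvB n s hs
      have h4 : ‖v n s - vbar s‖ ≤ 2 * ρ := by linarith
      nlinarith
    have hd : d s = (N : ℝ)⁻¹ • ∑ n, (F (v n s) - F (vbar s)) + (F (vbar s) - F (u s)) := by
      simp only [d, Finset.sum_sub_distrib, smul_sub, Finset.sum_const, Finset.card_univ,
        Fintype.card_fin]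
      rw [← Nat.cast_smul_eq_nsmul ℝ, smul_smul, inv_mul_cancel₀ hN0.ne', one_smul]
      abel
    have hdn : ‖d s‖ ≤ 2 * β * ρ + β * ‖vbar s - u s‖ := by
      rw [hd]
      exact (norm_add_le _ _).trans (add_le_add hR (hF _ _ hb (huB s hs)))
    have hi := real_inner_le_norm (vbar s - u s) (d s)
    set x := ‖vbar s - u s‖
    have hx : 0 ≤ x := norm_nonneg _
    have h5 := mul_le_mul_of_nonneg_left hdn hx
    have h6 : 2 * (x * (2 * β * ρ)) ≤ 2 * ε * x ^ 2 + k * D := by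
      have : ε * (2 * (x * (2 * β * ρ))) ≤ ε * (2 * ε * x ^ 2 + k * D) := by
        nlinarith [sq_nonneg (ε * x - β * ρ)]
      exact le_of_mul_le_mul_left this hε
    rw [hk] at h6 ⊢
    nlinarith
  have hg : ∀ s ∈ Set.Icc (0 : ℝ) t,
      HasDerivAt (fun s => Real.exp (-k * s) * (‖vbar s - u s‖ ^ 2 + D))
        (Real.exp (-k * s) * (-k * 1) * (‖vbar s - u s‖ ^ 2 + D) +
          Real.exp (-k * s) * (2 * inner ℝ (vbar s - u s) (d s))) s := by
    intro s hs
    exact (((hasDerivAt_id s).const_mul (-k)).exp).mul ((he s hs).norm_sq.add_const D)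
  have hanti : AntitoneOn (fun s => Real.exp (-k * s) * (‖vbar s - u s‖ ^ 2 + D))
      (Set.Icc 0 t) := by
    apply antitoneOn_of_deriv_nonpos (convex_Icc 0 t)
    · exact fun s hs => (hg s hs).continuousAt.continuousWithinAt
    · exact fun s hs => (hg s (interior_subset hs)).differentiableAt.differentiableWithinAt
    · intro s hs
      have hs' := interior_subset hs
      rw [(hg s hs').deriv]
      have := mul_le_mul_of_nonneg_left (key s hs') (Real.exp_pos (-k * s)).le
      linarith
  have h := hanti (Set.left_mem_Icc.2 ht.le) (Set.right_mem_Icc.2 ht.le) ht.le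
  simp only [mul_zero, Real.exp_zero, one_mul] at h
  have h7 := mul_le_mul_of_nonneg_left h (Real.exp_pos (k * t)).le
  rw [← mul_assoc, ← Real.exp_add] at h7
  simp only [neg_mul, add_neg_cancel, Real.exp_zero, one_mul] at h7
  linarith
end

section
/- Let U be a real Hilbert space, F : U → U continuous, N ≥ 2, and v^(n) : I → U differentiable curves on an interval I with (v^(n))'(t) = F(v^(n)(t)) for n = 1, …, N. Let v̄(t) = (1/N)∑_{n=1}^N v^(n)(t) and Ĉ(t) = (1/(N−1))∑_{n=1}^N (v^(n)(t) − v̄(t)) ⊗ (v^(n)(t) − v̄(t)). Then t ↦ Ĉ(t) is differentiable (as a curve of bounded operators) with derivative dĈ/dt(t) = (1/(N−1))∑_{n=1}^N [(F(v^(n)(t)) − F(v̄(t))) ⊗ (v^(n)(t) − v̄(t)) + (v^(n)(t) − v̄(t)) ⊗ (F(v^(n)(t)) − F(v̄(t)))]. -/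
open scoped RealInnerProductSpace

theorem rankOne_bdd {U : Type*} [NormedAddCommGroup U] [InnerProductSpace ℝ U] :
    IsBoundedBilinearMap ℝ (fun p : U × U => rankOne p.1 p.2) where
  add_left x y z := by ext w; simp [rankOne]
  smul_left c x y := by ext w; simp [rankOne, smul_smul, mul_comm]
  add_right x y z := by ext w; simp [rankOne, inner_add_left, add_smul]
  smul_right c x y := by ext w; simp [rankOne, inner_smul_left, mul_smul]
  bound := ⟨1, one_pos, fun x y => by
    simp [rankOne, ContinuousLinearMap.norm_smulRight_apply, mul_comm]⟩

theorem rankOne_sum_left {U : Type*} [NormedAddCommGroup U] [InnerProductSpace ℝ U]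
    {N : ℕ} (f : Fin N → U) (c : U) : ∑ n, rankOne (f n) c = rankOne (∑ n, f n) c := by
  ext w; simp [rankOne, Finset.smul_sum]

theorem rankOne_sum_right {U : Type*} [NormedAddCommGroup U] [InnerProductSpace ℝ U]
    {N : ℕ} (f : Fin N → U) (c : U) : ∑ n, rankOne c (f n) = rankOne c (∑ n, f n) := by
  ext w; simp [rankOne, sum_inner, Finset.sum_smul]

/-- equations (3.9)–(3.10): if each ensemble member solves
`(v⁽ⁿ⁾)' = F(v⁽ⁿ⁾)` on an interval `I`, then the ensemble covariance
`Ĉ(t) = (N−1)⁻¹ ∑ (v⁽ⁿ⁾(t) − v̄(t)) ⊗ (v⁽ⁿ⁾(t) − v̄(t))` is differentiable in `t` with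
`dĈ/dt = (N−1)⁻¹ ∑ [(F(v⁽ⁿ⁾) − F(v̄)) ⊗ (v⁽ⁿ⁾ − v̄) + (v⁽ⁿ⁾ − v̄) ⊗ (F(v⁽ⁿ⁾) − F(v̄))]`. -/
theorem stmt11 {U : Type*} [NormedAddCommGroup U] [InnerProductSpace ℝ U]
    (F : U → U) (hF : Continuous F) (N : ℕ) (hN : 2 ≤ N)
    (I : Set ℝ) (v : Fin N → ℝ → U)
    (hv : ∀ n, ∀ t ∈ I, HasDerivWithinAt (v n) (F (v n t)) I t)
    (vbar : ℝ → U) (hvbar : ∀ t, vbar t = (N : ℝ)⁻¹ • ∑ n, v n t)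
    (C : ℝ → U →L[ℝ] U)
    (hC : ∀ t, C t = ((N : ℝ) - 1)⁻¹ •
      ∑ n, rankOne (v n t - vbar t) (v n t - vbar t)) :
    ∀ t ∈ I, HasDerivWithinAt C
      (((N : ℝ) - 1)⁻¹ • ∑ n,
        (rankOne (F (v n t) - F (vbar t)) (v n t - vbar t)
          + rankOne (v n t - vbar t) (F (v n t) - F (vbar t)))) I t := by
  intro t ht
  have hN0 : (N : ℝ) ≠ 0 := by
    have : N ≠ 0 := by omega
    exact_mod_cast this
  have hb : HasDerivWithinAt vbar ((N : ℝ)⁻¹ • ∑ n, F (v n t)) I t := by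
    rw [show vbar = fun t => (N : ℝ)⁻¹ • ∑ n, v n t from funext hvbar]
    exact (HasDerivWithinAt.fun_sum fun n _ => hv n t ht).const_smul _
  set m := (N : ℝ)⁻¹ • ∑ n, F (v n t) with hm
  have hd0 : ∑ n, (v n t - vbar t) = 0 := by
    rw [Finset.sum_sub_distrib, hvbar t]
    simp [← Nat.cast_smul_eq_nsmul ℝ, smul_smul, hN0]
  have key : ∀ n, HasDerivWithinAt (fun t => rankOne (v n t - vbar t) (v n t - vbar t))
      (rankOne (v n t - vbar t) (F (v n t) - m) + rankOne (F (v n t) - m) (v n t - vbar t)) I t := by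
    intro n
    have hd := (hv n t ht).sub hb
    exact (rankOne_bdd.hasFDerivAt (v n t - vbar t, v n t - vbar t)).comp_hasDerivWithinAt t
      (hd.prodMk hd)
  rw [show C = _ from funext hC]
  have := (HasDerivWithinAt.fun_sum (u := Finset.univ) fun n _ => key n).const_smul ((N : ℝ) - 1)⁻¹
  refine this.congr_deriv ?_
  congr 1
  have e1 : ∀ n, rankOne (F (v n t) - F (vbar t)) (v n t - vbar t)
      = rankOne (F (v n t) - m) (v n t - vbar t) + rankOne (m - F (vbar t)) (v n t - vbar t) := by
    intro n
    rw [← rankOne_bdd.add_left]; simp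
  have e2 : ∀ n, rankOne (v n t - vbar t) (F (v n t) - F (vbar t))
      = rankOne (v n t - vbar t) (F (v n t) - m) + rankOne (v n t - vbar t) (m - F (vbar t)) := by
    intro n
    rw [← rankOne_bdd.add_right]; simp
  simp only [e1, e2, Finset.sum_add_distrib, rankOne_sum_left (fun n => v n t - vbar t),
    rankOne_sum_right (fun n => v n t - vbar t), hd0]
  have z1 : ∀ c : U, rankOne c 0 = 0 := fun c => by ext; simp [rankOne]
  have z2 : ∀ c : U, rankOne 0 c = 0 := fun c => by ext; simp [rankOne]
  rw [z1, z2, add_zero, add_zero, add_comm]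
end

section
/- Let U be a real Hilbert space, N ≥ 2, α > 0, γ > 0, and dV̂ = (d^(1), …, d^(N)) ∈ U^N. Let Ĉ = (1/(N−1))∑_{n=1}^N d^(n) ⊗ d^(n), let C̃ = (1/(N−1))·dV̂*dV̂ ∈ ℝ^{N×N} be the normalized Gram matrix, and define C = (α²/(N−1))·dV̂·(I_N + α²γ^{-2}C̃)^{-1}·dV̂*. If φ ∈ U satisfies Ĉφ = λφ for some λ ≥ 0, then Cφ = (α²λ/(1 + α²γ^{-2}λ))·φ. -/
open scoped RealInnerProductSpace

/-- eigenvector transfer in Theorem 3.9: every eigenvector `φ` of the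
prediction covariance `Ĉ = (N−1)⁻¹ ∑ d⁽ⁿ⁾ ⊗ d⁽ⁿ⁾` with eigenvalue `λ ≥ 0` is an
eigenvector of the (inflated) analysis covariance
`C = (α²/(N−1)) dV̂ (I_N + α²γ⁻²C̃)⁻¹ dV̂*` with eigenvalue `α²λ/(1 + α²γ⁻²λ)`. -/
theorem stmt13 {U : Type*} [NormedAddCommGroup U] [InnerProductSpace ℝ U]
    (N : ℕ) (hN : 2 ≤ N) (α γ : ℝ) (hα : 0 < α) (hγ : 0 < γ)
    (d : Fin N → U)
    (Ch : U →L[ℝ] U) (hCh : Ch = ((N : ℝ) - 1)⁻¹ • ∑ n, rankOne (d n) (d n))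
    (Ct : Matrix (Fin N) (Fin N) ℝ)
    (hCt : Ct = Matrix.of fun i j => ((N : ℝ) - 1)⁻¹ * ⟪d i, d j⟫)
    (C : U →L[ℝ] U)
    (hC : C = (α ^ 2 * ((N : ℝ) - 1)⁻¹) •
      ∑ i, ∑ j, (1 + (α ^ 2 * (γ ^ 2)⁻¹) • Ct)⁻¹ i j • rankOne (d i) (d j))
    (φ : U) (lam : ℝ) (hlam : 0 ≤ lam) (hφ : Ch φ = lam • φ) :
    C φ = (α ^ 2 * lam / (1 + α ^ 2 * (γ ^ 2)⁻¹ * lam)) • φ := by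
  have hN1 : (0 : ℝ) < (N : ℝ) - 1 := by
    have : (2 : ℝ) ≤ N := by exact_mod_cast hN
    linarith
  set c : ℝ := ((N : ℝ) - 1)⁻¹ with hc
  have hc0 : 0 ≤ c := by positivity
  set a : ℝ := α ^ 2 * (γ ^ 2)⁻¹ with ha
  have ha0 : 0 ≤ a := by positivity
  have hpos : 0 < 1 + a * lam := by positivity
  have hCt2 : Ct = c • Matrix.gram ℝ d := by
    rw [hCt]; ext i j; simp [Matrix.gram]
  have hM : (1 + a • Ct).PosDef := by
    refine Matrix.PosDef.one.add_posSemidef ?_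
    rw [hCt2]
    exact ((Matrix.posSemidef_gram ℝ d).smul hc0).smul ha0
  have hdet : IsUnit (1 + a • Ct).det := hM.det_pos.ne'.isUnit
  have hsum : c • ∑ n, ⟪d n, φ⟫ • d n = lam • φ := by
    rw [← hφ, hCh]
    simp [rankOne]
  set v : Fin N → ℝ := fun j => ⟪d j, φ⟫ with hv
  have hMv : (1 + a • Ct).mulVec v = (1 + a * lam) • v := by
    suffices hs : Ct.mulVec v = lam • v by
      rw [Matrix.add_mulVec, Matrix.one_mulVec, Matrix.smul_mulVec, add_smul, one_smul, hs, smul_smul]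
    ext i
    have h := congrArg (fun x => ⟪d i, x⟫) hsum
    simp only [inner_smul_right, inner_sum] at h
    simp only [Matrix.mulVec, dotProduct, hCt, Matrix.of_apply, Pi.smul_apply, smul_eq_mul, hv]
    rw [← h, Finset.mul_sum]
    refine Finset.sum_congr rfl fun j _ => ?_
    ring
  have hinv : (1 + a • Ct)⁻¹.mulVec v = (1 + a * lam)⁻¹ • v := by
    have h := congrArg (fun x => (1 + a * lam)⁻¹ • (1 + a • Ct)⁻¹.mulVec x) hMv
    simp only [Matrix.mulVec_mulVec, Matrix.nonsing_inv_mul _ hdet, Matrix.one_mulVec,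
      Matrix.mulVec_smul, smul_smul, inv_mul_cancel₀ hpos.ne', one_smul] at h
    exact h.symm
  have hCφ : C φ = (α ^ 2 * c) • ∑ i, ((1 + a • Ct)⁻¹.mulVec v) i • d i := by
    rw [hC]
    simp [rankOne, Matrix.mulVec, dotProduct, Finset.sum_smul,
      smul_smul, hv]
  rw [hCφ, hinv]
  simp only [Pi.smul_apply, smul_eq_mul, mul_smul, ← Finset.smul_sum]
  rw [smul_comm c, hsum, smul_smul, smul_smul]
  congr 1
  field_simp
end

section
/- Let m, N ∈ ℕ with N ≥ 2, α > 0, γ > 0, and dV̂ = (d^(1), …, d^(N)) a tuple of vectors in ℝ^m. Let Ĉ = (1/(N−1))∑_{n=1}^N d^(n)(d^(n))ᵀ, let C̃ = (1/(N−1))·dV̂*dV̂ ∈ ℝ^{N×N} be the normalized Gram matrix, and define C = (α²/(N−1))·dV̂·(I_N + α²γ^{-2}C̃)^{-1}·dV̂*. Then the minimum eigenvalues of the symmetric positive semidefinite matrices C and Ĉ satisfy λ_min(C) = α²·λ_min(Ĉ)/(1 + α²γ^{-2}·λ_min(Ĉ)). -/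
open scoped Matrix

lemma aux_eig {m : ℕ} (A : Matrix (Fin m) (Fin m) ℝ) (hA : A.IsHermitian) (v : Fin m → ℝ)
    (hv : v ≠ 0) (μ : ℝ) (h : A *ᵥ v = μ • v) : ∃ i, hA.eigenvalues i = μ := by
  have h1 : Module.End.HasEigenvalue (Matrix.toLin' A) μ :=
    Module.End.hasEigenvalue_of_hasEigenvector (x := v)
      ⟨by rw [Module.End.mem_eigenspace_iff]; simpa using h, hv⟩
  have h2 := h1.mem_spectrum
  rw [Matrix.spectrum_toLin', hA.spectrum_real_eq_range_eigenvalues] at h2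
  exact h2

lemma aux_vec {m : ℕ} (A : Matrix (Fin m) (Fin m) ℝ) (hA : A.IsHermitian) (i : Fin m) :
    ∃ v : Fin m → ℝ, v ≠ 0 ∧ A *ᵥ v = hA.eigenvalues i • v := by
  refine ⟨hA.eigenvectorBasis i, ?_, hA.mulVec_eigenvectorBasis i⟩
  intro h
  apply hA.eigenvectorBasis.orthonormal.ne_zero i
  ext j
  exact congrFun h j

lemma aux_main {m : ℕ} (hm : 0 < m) (a b : ℝ) (ha : 0 < a) (hb : 0 < b)
    (C Ch : Matrix (Fin m) (Fin m) ℝ) (hP : Ch.PosSemidef)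
    (h1 : C * (1 + b • Ch) = a • Ch) (h2 : (1 + b • Ch) * C = a • Ch)
    (hCH : C.IsHermitian) (hChH : Ch.IsHermitian) :
    (⨅ i, hCH.eigenvalues i)
        = a * (⨅ i, hChH.eigenvalues i) / (1 + b * ⨅ i, hChH.eigenvalues i) := by
  have : Nonempty (Fin m) := ⟨⟨0, hm⟩⟩
  have hnn : ∀ i, 0 ≤ hChH.eigenvalues i := fun i => hP.eigenvalues_nonneg i
  obtain ⟨i0, hi0⟩ := exists_eq_ciInf_of_finite (f := hChH.eigenvalues)
  have hbd1 : BddBelow (Set.range hChH.eigenvalues) := (Set.finite_range _).bddBelow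
  have hbd2 : BddBelow (Set.range hCH.eigenvalues) := (Set.finite_range _).bddBelow
  have hle : ∀ i, hChH.eigenvalues i0 ≤ hChH.eigenvalues i := fun i => by
    rw [hi0]; exact ciInf_le hbd1 i
  rw [← hi0]
  apply le_antisymm
  · obtain ⟨v, hv, hvv⟩ := aux_vec Ch hChH i0
    have hpos : 0 < 1 + b * hChH.eigenvalues i0 := by have := mul_nonneg hb.le (hnn i0); linarith
    set l := hChH.eigenvalues i0
    have h3 : (1 + b * l) • (C *ᵥ v) = (a * l) • v := by
      have := congrArg (· *ᵥ v) h1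
      simp only [← Matrix.mulVec_mulVec, Matrix.add_mulVec, Matrix.one_mulVec,
        Matrix.smul_mulVec, hvv] at this
      rw [smul_smul, smul_smul] at this
      rw [← this, ← Matrix.mulVec_smul, add_smul, one_smul]
    obtain ⟨j, hj⟩ := aux_eig C hCH v hv (a * l / (1 + b * l)) (by
      rw [div_eq_inv_mul, mul_smul, ← h3, smul_smul, inv_mul_cancel₀ hpos.ne', one_smul])
    rw [← hj]
    exact ciInf_le hbd2 j
  · apply le_ciInf
    intro j
    obtain ⟨v, hv, hvv⟩ := aux_vec C hCH j
    set μ := hCH.eigenvalues j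
    have h3 : (a - b * μ) • (Ch *ᵥ v) = μ • v := by
      have := congrArg (· *ᵥ v) h2
      simp only [← Matrix.mulVec_mulVec, Matrix.add_mulVec, Matrix.one_mulVec,
        Matrix.smul_mulVec, hvv, Matrix.mulVec_smul] at this
      rw [sub_smul, ← this, smul_add, smul_smul, mul_comm μ b]
      abel
    have hne : a - b * μ ≠ 0 := by
      intro h0
      rw [h0, zero_smul] at h3
      have : μ = 0 := by
        rcases smul_eq_zero.1 h3.symm with h | h
        · exact h
        · exact absurd h hv
      rw [this] at h0
      simp at h0
      exact ha.ne' h0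
    obtain ⟨i, hi⟩ := aux_eig Ch hChH v hv (μ / (a - b * μ)) (by
      rw [div_eq_inv_mul, mul_smul, ← h3, smul_smul, inv_mul_cancel₀ hne, one_smul])
    have p0 : 0 < 1 + b * hChH.eigenvalues i0 := by have := mul_nonneg hb.le (hnn i0); linarith
    have p1 : 0 < 1 + b * hChH.eigenvalues i := by have := mul_nonneg hb.le (hnn i); linarith
    have hμ : μ = a * hChH.eigenvalues i / (1 + b * hChH.eigenvalues i) := by
      rw [eq_div_iff p1.ne']
      rw [eq_div_iff hne] at hi
      linarith
    rw [hμ, div_le_div_iff₀ p0 p1]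
    have := mul_le_mul_of_nonneg_left (hle i) ha.le
    linarith

/-- equation (3.12), minimum-eigenvalue update: for deviation vectors
`d⁽¹⁾, …, d⁽ᴺ⁾` in `ℝᵐ`, prediction covariance `Ĉ = (N−1)⁻¹ ∑ d⁽ⁿ⁾(d⁽ⁿ⁾)ᵀ`, normalized
Gram matrix `C̃`, and analysis covariance `C = (α²/(N−1)) dV̂ (I_N + α²γ⁻²C̃)⁻¹ dV̂*`, the
minimum eigenvalues satisfy `λ_min(C) = α² λ_min(Ĉ) / (1 + α²γ⁻² λ_min(Ĉ))`. -/
theorem stmt14 (m N : ℕ) (hm : 0 < m) (hN : 2 ≤ N) (α γ : ℝ) (hα : 0 < α) (hγ : 0 < γ)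
    (d : Fin N → Fin m → ℝ)
    (Ch : Matrix (Fin m) (Fin m) ℝ)
    (hCh : Ch = ((N : ℝ) - 1)⁻¹ • ∑ n, Matrix.vecMulVec (d n) (d n))
    (Ct : Matrix (Fin N) (Fin N) ℝ)
    (hCt : Ct = Matrix.of fun i j => ((N : ℝ) - 1)⁻¹ * (d i ⬝ᵥ d j))
    (C : Matrix (Fin m) (Fin m) ℝ)
    (hC : C = (α ^ 2 * ((N : ℝ) - 1)⁻¹) •
      ∑ i, ∑ j, (1 + (α ^ 2 * (γ ^ 2)⁻¹) • Ct)⁻¹ i j • Matrix.vecMulVec (d i) (d j)) :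
    ∀ (hCH : C.IsHermitian) (hChH : Ch.IsHermitian),
      (⨅ i, hCH.eigenvalues i)
        = α ^ 2 * (⨅ i, hChH.eigenvalues i)
          / (1 + α ^ 2 * (γ ^ 2)⁻¹ * ⨅ i, hChH.eigenvalues i) := by
  intro hCH hChH
  have hN' : (2 : ℝ) ≤ N := by exact_mod_cast hN
  set s : ℝ := ((N : ℝ) - 1)⁻¹ with hs
  have hs0 : 0 < s := inv_pos.2 (by linarith)
  set D : Matrix (Fin m) (Fin N) ℝ := Matrix.of fun k n => d n k with hD
  have hb : 0 < α ^ 2 * (γ ^ 2)⁻¹ := by positivity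
  set b := α ^ 2 * (γ ^ 2)⁻¹
  have eCh : Ch = s • (D * Dᵀ) := by
    rw [hCh]
    ext k l
    simp [Matrix.sum_apply, Matrix.vecMulVec_apply, Matrix.mul_apply, hD]
  have eCt : Ct = s • (Dᵀ * D) := by
    rw [hCt]
    ext k l
    simp [Matrix.mul_apply, hD, dotProduct]
  have pCt : Ct.PosSemidef := by
    rw [eCt]
    exact (Matrix.posSemidef_conjTranspose_mul_self D).smul hs0.le
  have pCh : Ch.PosSemidef := by
    rw [eCh]
    exact (Matrix.posSemidef_self_mul_conjTranspose D).smul hs0.le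
  have pM : (1 + b • Ct).PosDef := Matrix.PosDef.one.add_posSemidef (pCt.smul hb.le)
  have uM : IsUnit (1 + b • Ct).det := (Matrix.isUnit_iff_isUnit_det _).1 pM.isUnit
  have eC : C = (α ^ 2 * s) • (D * (1 + b • Ct)⁻¹ * Dᵀ) := by
    rw [hC]
    congr 1
    generalize (1 + b • Ct)⁻¹ = M
    ext k l
    simp only [Matrix.sum_apply, Matrix.vecMulVec_apply, Matrix.mul_apply, hD, Matrix.smul_apply,
      Matrix.transpose_apply, Matrix.of_apply, smul_eq_mul, Finset.sum_mul]
    rw [Finset.sum_comm]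
    refine Finset.sum_congr rfl fun i _ => Finset.sum_congr rfl fun j _ => by ring
  have c1 : Dᵀ * (1 + b • Ch) = (1 + b • Ct) * Dᵀ := by
    rw [eCh, eCt]
    simp [Matrix.mul_add, Matrix.add_mul, Matrix.mul_assoc]
  have c2 : (1 + b • Ch) * D = D * (1 + b • Ct) := by
    rw [eCh, eCt]
    simp [Matrix.mul_add, Matrix.add_mul, Matrix.mul_assoc]
  refine aux_main hm (α ^ 2) b (by positivity) hb C Ch pCh ?_ ?_ hCH hChH
  · rw [eC, Matrix.smul_mul, Matrix.mul_assoc, c1, Matrix.mul_assoc,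
      Matrix.nonsing_inv_mul_cancel_left _ _ uM, eCh, smul_smul]
  · rw [eC, Matrix.mul_smul, ← Matrix.mul_assoc, ← Matrix.mul_assoc, c2,
      Matrix.mul_nonsing_inv_cancel_right _ _ uM, eCh, smul_smul]
end
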